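/- Let m ≥ 1 and let ρ_1,…,ρ_m and σ_1,…,σ_m be pure qubit states, i.e. rank-one orthogonal projections in the 2×2 complex matrices, such that Re tr(ρ_i ρ_j) = Re tr(σ_i σ_j) for all i,j ∈ [m]. Then there exists a 2×2 unitary matrix U such that either σ_i = U ρ_i U* for all i ∈ [m], or σ_i = U (ρ_i)ᵀ U* for all i ∈ [m], where (·)ᵀ denotes transposition in a fixed basis of ℂ². (The exact (ε = 0) case of Theorem 2: two families of pure qubit states with identical pairwise overlaps are related by a single unitary, possibly composed with a global transposition.) -/

import Mathlib

open Matrix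
open scoped ComplexOrder

/-- A pure qubit state: a rank-one orthogonal projection in the 2×2 complex
matrices (Hermitian, idempotent, trace one). -/
def IsPureState (ρ : Matrix (Fin 2) (Fin 2) ℂ) : Prop :=
  ρ.IsHermitian ∧ ρ * ρ = ρ ∧ ρ.trace = 1

open ComplexConjugate in
/-- A pure qubit state in matrix coordinates. -/
theorem IsPureState.exists_eq_of {ρ : Matrix (Fin 2) (Fin 2) ℂ} (h : IsPureState ρ) :
    ∃ (a : ℝ) (z : ℂ), ρ = !![(a : ℂ), z; conj z, 1 - a] ∧ z * conj z = a * (1 - a) := by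
  obtain ⟨hH, hI, hT⟩ := h
  have h00 : conj (ρ 0 0) = ρ 0 0 := hH.apply 0 0
  have h10 : conj (ρ 0 1) = ρ 1 0 := hH.apply 1 0
  obtain ⟨a, ha⟩ := Complex.conj_eq_iff_real.mp h00
  rw [Matrix.trace_fin_two] at hT
  have h11 : ρ 1 1 = 1 - a := by rw [← hT, ha]; ring
  refine ⟨a, ρ 0 1, ?_, ?_⟩
  · rw [h10, ← h11, ← ha]
    exact Matrix.eta_fin_two ρ
  · have h := congrFun (congrFun hI 0) 0
    rw [Matrix.mul_apply, Fin.sum_univ_two, ha] at h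
    rw [h10]
    linear_combination h

theorem IsPureState.conj_unitary {ρ V : Matrix (Fin 2) (Fin 2) ℂ} (h : IsPureState ρ)
    (hV : V ∈ Matrix.unitaryGroup (Fin 2) ℂ) : IsPureState (Vᴴ * ρ * V) := by
  obtain ⟨hH, hI, hT⟩ := h
  have hV' : V * Vᴴ = 1 := Matrix.mem_unitaryGroup_iff.mp hV
  refine ⟨Matrix.isHermitian_conjTranspose_mul_mul V hH, ?_, ?_⟩
  · calc Vᴴ * ρ * V * (Vᴴ * ρ * V) = Vᴴ * ρ * (V * Vᴴ) * ρ * V := by simp only [Matrix.mul_assoc]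
      _ = Vᴴ * (ρ * ρ) * V := by rw [hV', Matrix.mul_one]; simp only [Matrix.mul_assoc]
      _ = Vᴴ * ρ * V := by rw [hI]
  · rw [Matrix.trace_mul_comm, ← Matrix.mul_assoc, hV', Matrix.one_mul, hT]

theorem trace_conj_unitary_mul {ρ τ V : Matrix (Fin 2) (Fin 2) ℂ}
    (hV : V ∈ Matrix.unitaryGroup (Fin 2) ℂ) :
    ((Vᴴ * ρ * V) * (Vᴴ * τ * V)).trace = (ρ * τ).trace := by
  have hV' : V * Vᴴ = 1 := Matrix.mem_unitaryGroup_iff.mp hV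
  calc ((Vᴴ * ρ * V) * (Vᴴ * τ * V)).trace = (Vᴴ * (ρ * (V * Vᴴ) * τ * V)).trace := by
        simp only [Matrix.mul_assoc]
    _ = (ρ * τ).trace := by
        rw [Matrix.trace_mul_comm, hV', Matrix.mul_one, Matrix.mul_assoc, hV', Matrix.mul_one]

/-- Every pure qubit state is unitarily equivalent to the first basis state. -/
theorem IsPureState.exists_unitary {ρ : Matrix (Fin 2) (Fin 2) ℂ} (h : IsPureState ρ) :
    ∃ V ∈ Matrix.unitaryGroup (Fin 2) ℂ, Vᴴ * ρ * V = !![1, 0; 0, 0] := by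
  suffices ∃ V ∈ Matrix.unitaryGroup (Fin 2) ℂ, ρ = V * !![1, 0; 0, 0] * Vᴴ by
    obtain ⟨V, hV, rfl⟩ := this
    have hV' : Vᴴ * V = 1 := Matrix.mem_unitaryGroup_iff'.mp hV
    refine ⟨V, hV, ?_⟩
    calc Vᴴ * (V * !![1, 0; 0, 0] * Vᴴ) * V = (Vᴴ * V) * !![1, 0; 0, 0] * (Vᴴ * V) := by
          simp only [Matrix.mul_assoc]
      _ = !![1, 0; 0, 0] := by rw [hV', Matrix.one_mul, Matrix.mul_one]
  obtain ⟨a, z, rfl, hz⟩ := h.exists_eq_of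
  by_cases ha : a = 0
  · subst ha
    have hz0 : z = 0 := by simpa using hz
    subst hz0
    refine ⟨!![0, 1; 1, 0], ?_, ?_⟩
    · rw [Matrix.mem_unitaryGroup_iff, Matrix.star_eq_conjTranspose]
      ext i j
      fin_cases i <;> fin_cases j <;> simp [Matrix.mul_apply, Fin.sum_univ_two]
    · ext i j
      fin_cases i <;> fin_cases j <;> simp [Matrix.mul_apply, Fin.sum_univ_two]
  · have hpos : 0 < a := by
      have h1 : Complex.normSq z = a * (1 - a) := by
        rw [Complex.mul_conj] at hz
        exact_mod_cast hz
      have h2 := Complex.normSq_nonneg z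
      have h3 := mul_self_pos.mpr ha
      nlinarith
    obtain ⟨s, hs⟩ : ∃ s : ℝ, s * s * a = 1 :=
      ⟨(√a)⁻¹, by rw [← mul_inv, Real.mul_self_sqrt hpos.le, inv_mul_cancel₀ ha]⟩
    have hs' : (s : ℂ) * s * a = 1 := by exact_mod_cast hs
    refine ⟨!![s * a, s * z; s * star z, -(s * a)], ?_, ?_⟩
    · rw [Matrix.mem_unitaryGroup_iff, Matrix.star_eq_conjTranspose]
      ext i j
      fin_cases i <;> fin_cases j <;> simp [Matrix.mul_apply, Fin.sum_univ_two]
      · linear_combination s * s * hz + hs'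
      · ring
      · ring
      · linear_combination s * s * hz + hs'
    · ext i j
      fin_cases i <;> fin_cases j <;> simp [Matrix.mul_apply, Fin.sum_univ_two]
      · linear_combination (-a : ℂ) * hs'
      · linear_combination (-z : ℂ) * hs'
      · linear_combination (-(starRingEnd ℂ) z) * hs'
      · linear_combination (a - 1 : ℂ) * hs' - s * s * hz

open ComplexConjugate in
/-- Two families of plane vectors with the same Gram matrix differ by a rotation, possibly
composed with a reflection. -/
theorem exists_unit_mul_of_re_mul_conj_eq {ι : Type*} (z w : ι → ℂ)
    (h : ∀ i j, (z i * conj (z j)).re = (w i * conj (w j)).re) :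
    ∃ u : ℂ, u * conj u = 1 ∧ ((∀ i, w i = u * z i) ∨ (∀ i, w i = u * conj (z i))) := by
  have hnorm (i) : Complex.normSq (z i) = Complex.normSq (w i) := by
    simpa [Complex.mul_conj] using h i i
  by_cases hall : ∀ i, z i = 0
  · refine ⟨1, by simp, Or.inl fun i => ?_⟩
    have := hnorm i
    rw [hall i, map_zero, eq_comm, Complex.normSq_eq_zero] at this
    rw [this, hall i, mul_zero]
  push Not at hall
  obtain ⟨k, hk⟩ := hall
  have hN : z k * conj (z k) = w k * conj (w k) := by
    rw [Complex.mul_conj, Complex.mul_conj, hnorm k]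
  have hck : conj (z k) ≠ 0 := by simpa using hk
  have hwk : w k ≠ 0 := by
    rintro h0
    rw [h0, zero_mul] at hN
    exact mul_ne_zero hk hck hN
  have hcw : conj (w k) ≠ 0 := by simpa using hwk
  set p : ι → ℂ := fun i => z i * conj (z k) with hp
  set q : ι → ℂ := fun i => w i * conj (w k) with hq
  have hre (i) : (p i).re = (q i).re := h i k
  have hpq (i j) : (p i * conj (p j)).re = (q i * conj (q j)).re := by
    have e1 : p i * conj (p j) = (Complex.normSq (z k) : ℂ) * (z i * conj (z j)) := by
      simp only [hp, map_mul, Complex.conj_conj, ← Complex.mul_conj]; ring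
    have e2 : q i * conj (q j) = (Complex.normSq (w k) : ℂ) * (w i * conj (w j)) := by
      simp only [hq, map_mul, Complex.conj_conj, ← Complex.mul_conj]; ring
    rw [e1, e2, Complex.re_ofReal_mul, Complex.re_ofReal_mul, hnorm k, h i j]
  have him (i j) : (p i).im * (p j).im = (q i).im * (q j).im := by
    have := hpq i j
    simp only [Complex.mul_re, Complex.conj_re, Complex.conj_im, hre] at this
    linarith
  have key : (∀ i, q i = p i) ∨ (∀ i, q i = conj (p i)) := by
    by_cases hreal : ∀ i, (p i).im = 0
    · refine Or.inl fun i => Complex.ext (hre i).symm ?_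
      have := him i i
      rw [hreal i, mul_zero, eq_comm, mul_self_eq_zero] at this
      rw [this, hreal i]
    push Not at hreal
    obtain ⟨l, hl⟩ := hreal
    rcases mul_self_eq_mul_self_iff.mp (him l l) with hs | hs
    · refine Or.inl fun i => Complex.ext (hre i).symm (mul_right_cancel₀ hl ?_)
      rw [him i l, hs]
    · refine Or.inr fun i => Complex.ext (hre i).symm (mul_right_cancel₀ hl ?_)
      rw [Complex.conj_im, neg_mul, him i l, hs, mul_neg]
  rcases key with key | key
  · refine ⟨w k / z k, ?_, Or.inl fun i => ?_⟩
    · rw [map_div₀, div_mul_div_comm, ← hN, div_self (mul_ne_zero hk hck)]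
    · refine mul_right_cancel₀ hcw ((key i).trans ?_)
      simp only [hp]
      field_simp
      linear_combination z i * hN
  · refine ⟨w k / conj (z k), ?_, Or.inr fun i => ?_⟩
    · rw [map_div₀, div_mul_div_comm, ← hN, Complex.conj_conj, mul_comm (conj (z k)),
        div_self (mul_ne_zero hk hck)]
    · refine mul_right_cancel₀ hcw ((key i).trans ?_)
      simp only [hp, map_mul, Complex.conj_conj]
      field_simp
      linear_combination conj (z i) * hN

/-- The self-testing statement for families sharing a basis state. -/
theorem exists_unitary_of_basis_state {ι : Type*} (k : ι)
    (ρ σ : ι → Matrix (Fin 2) (Fin 2) ℂ)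
    (hρ : ∀ i, IsPureState (ρ i)) (hσ : ∀ i, IsPureState (σ i))
    (hover : ∀ i j, ((ρ i * ρ j).trace).re = ((σ i * σ j).trace).re)
    (hρk : ρ k = !![1, 0; 0, 0]) (hσk : σ k = !![1, 0; 0, 0]) :
    ∃ U ∈ Matrix.unitaryGroup (Fin 2) ℂ,
      (∀ i, σ i = U * ρ i * Uᴴ) ∨ (∀ i, σ i = U * (ρ i)ᵀ * Uᴴ) := by
  choose a z hρz _ using fun i => (hρ i).exists_eq_of
  choose b w hσw _ using fun i => (hσ i).exists_eq_of
  have hab (i) : b i = a i := by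
    have := hover i k
    rw [hρk, hσk, hρz, hσw] at this
    simpa [Matrix.trace_fin_two] using this.symm
  have hgram (i j) : (z i * (starRingEnd ℂ) (z j)).re = (w i * (starRingEnd ℂ) (w j)).re := by
    have := hover i j
    rw [hρz i, hρz j, hσw i, hσw j, hab i, hab j] at this
    simp [Matrix.trace_fin_two] at this
    simp
    linarith
  obtain ⟨u, hu, hzw⟩ := exists_unit_mul_of_re_mul_conj_eq z w hgram
  refine ⟨!![u, 0; 0, 1], ?_, hzw.imp (fun hzw i => ?_) fun hzw i => ?_⟩
  · rw [Matrix.mem_unitaryGroup_iff, Matrix.star_eq_conjTranspose]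
    ext i j
    fin_cases i <;> fin_cases j <;> simp [Matrix.mul_apply, Fin.sum_univ_two, hu]
  all_goals
    rw [hρz i, hσw i, hab i, hzw i]
    ext r s
    fin_cases r <;> fin_cases s <;>
      simp [Matrix.mul_apply, Fin.sum_univ_two, Matrix.vecMul_transpose]
    · linear_combination (-a i : ℂ) * hu
    · ring

/-- Exact (ε = 0) case of Theorem 2: two families of pure qubit states with
identical pairwise overlaps are related by a single unitary, possibly composed
with a global transposition. -/
theorem qubit_selftesting_exact (m : ℕ) (hm : 1 ≤ m)
    (ρ σ : Fin m → Matrix (Fin 2) (Fin 2) ℂ)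
    (hρ : ∀ i, IsPureState (ρ i))
    (hσ : ∀ i, IsPureState (σ i))
    (hover : ∀ i j, ((ρ i * ρ j).trace).re = ((σ i * σ j).trace).re) :
    ∃ U : Matrix (Fin 2) (Fin 2) ℂ, U ∈ Matrix.unitaryGroup (Fin 2) ℂ ∧
      ((∀ i, σ i = U * ρ i * Uᴴ) ∨ (∀ i, σ i = U * (ρ i)ᵀ * Uᴴ)) := by
  let k : Fin m := ⟨0, hm⟩
  obtain ⟨V, hV, hVk⟩ := (hρ k).exists_unitary
  obtain ⟨W, hW, hWk⟩ := (hσ k).exists_unitary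
  obtain ⟨D, hD, h⟩ := exists_unitary_of_basis_state k
    (fun i => Vᴴ * ρ i * V) (fun i => Wᴴ * σ i * W)
    (fun i => (hρ i).conj_unitary hV) (fun i => (hσ i).conj_unitary hW)
    (fun i j => by rw [trace_conj_unitary_mul hV, trace_conj_unitary_mul hW, hover]) hVk hWk
  have hW' : W * Wᴴ = 1 := Matrix.mem_unitaryGroup_iff.mp hW
  have hσW (i) : σ i = W * (Wᴴ * σ i * W) * Wᴴ := by
    calc σ i = (W * Wᴴ) * σ i * (W * Wᴴ) := by rw [hW', Matrix.one_mul, Matrix.mul_one]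
      _ = W * (Wᴴ * σ i * W) * Wᴴ := by simp only [Matrix.mul_assoc]
  rcases h with h | h
  · refine ⟨W * D * Vᴴ, mul_mem (mul_mem hW hD) (Unitary.star_mem hV), Or.inl fun i => ?_⟩
    rw [hσW i, h i]
    simp only [Matrix.conjTranspose_mul, Matrix.conjTranspose_conjTranspose, Matrix.mul_assoc]
  · have hVT : Vᵀ ∈ Matrix.unitaryGroup (Fin 2) ℂ := by
      have hV' : Vᴴ * V = 1 := Matrix.mem_unitaryGroup_iff'.mp hV
      rw [Matrix.mem_unitaryGroup_iff, Matrix.star_eq_conjTranspose,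
        show Vᵀᴴ = Vᴴᵀ from rfl, ← Matrix.transpose_mul, hV', Matrix.transpose_one]
    refine ⟨W * D * Vᵀ, mul_mem (mul_mem hW hD) hVT, Or.inr fun i => ?_⟩
    rw [hσW i, h i]
    simp only [Matrix.conjTranspose_mul, Matrix.transpose_mul, Matrix.mul_assoc]
    rfl
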